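/- Let H be a complex Hilbert space and θ a bounded positive self-adjoint operator on H (θ ≥ 0). Then sinh(θ), defined by the continuous functional calculus applied to the function x ↦ sinh x on the spectrum of θ, is a Hilbert–Schmidt operator if and only if θ is a Hilbert–Schmidt operator; moreover ‖θ‖_HS ≤ ‖sinh(θ)‖_HS ≤ cosh(‖θ‖) · ‖θ‖_HS. -/

import Mathlib

open scoped ENNReal

/-- The Hilbert–Schmidt norm of an operator, computed with respect to a Hilbert basis
`b` (the value is independent of the choice of basis). -/
noncomputable def hsNorm {H : Type*} [NormedAddCommGroup H] [InnerProductSpace ℂ H]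
    [CompleteSpace H] {ι : Type*} (b : HilbertBasis ι ℂ H) (T : H →L[ℂ] H) : ℝ≥0∞ :=
  (∑' i : ι, (‖T (b i)‖₊ : ℝ≥0∞) ^ 2) ^ (1 / 2 : ℝ)

theorem norm_cfc_apply_le
    {H : Type*} [NormedAddCommGroup H] [InnerProductSpace ℂ H] [CompleteSpace H]
    (θ : H →L[ℂ] H) (f g : ℝ → ℝ) (hf : Continuous f) (hg : Continuous g)
    (h : ∀ t ∈ spectrum ℝ θ, f t * f t ≤ g t * g t) (x : H) :
    ‖cfc f θ x‖ ≤ ‖cfc g θ x‖ := by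
  have key : ∀ k : ℝ → ℝ, Continuous k →
      ‖cfc k θ x‖ ^ 2 = (inner ℂ (cfc (fun t => k t * k t) θ x) x).re := by
    intro k hk
    have hs : IsSelfAdjoint (cfc k θ) := cfc_predicate k θ
    rw [cfc_mul k k θ hk.continuousOn hk.continuousOn, mul_apply_eq_comp]
    have h1 := ContinuousLinearMap.adjoint_inner_left (cfc k θ) x (cfc k θ x)
    rw [hs.adjoint_eq] at h1
    rw [h1, inner_self_eq_norm_sq_to_K]
    norm_cast
  have hle : cfc (fun t => f t * f t) θ ≤ cfc (fun t => g t * g t) θ :=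
    cfc_mono h (hf.mul hf).continuousOn (hg.mul hg).continuousOn
  rw [ContinuousLinearMap.le_def] at hle
  have h2 := hle.re_inner_nonneg_left x
  rw [sub_apply, inner_sub_left] at h2
  have h3 : 0 ≤ ‖cfc g θ x‖ ^ 2 - ‖cfc f θ x‖ ^ 2 := by
    rw [key g hg, key f hf]
    simpa using h2
  exact abs_le_of_sq_le_sq' (by linarith) (norm_nonneg _) |>.2

theorem sinh_le_cosh_mul {t c : ℝ} (ht : 0 ≤ t) (htc : t ≤ c) :
    Real.sinh t ≤ Real.cosh c * t := by
  have h := Convex.image_sub_le_mul_sub_of_deriv_le (convex_Icc 0 t)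
    Real.continuous_sinh.continuousOn Real.differentiable_sinh.differentiableOn
    (C := Real.cosh c) (by
      intro y hy
      rw [interior_Icc] at hy
      rw [Real.deriv_sinh, Real.cosh_le_cosh, abs_of_pos hy.1, abs_of_nonneg (ht.trans htc)]
      exact hy.2.le.trans htc) 0 ⟨le_rfl, ht⟩ t ⟨ht, le_rfl⟩ ht
  simpa using h

theorem hsNorm_le_mul
    {H : Type*} [NormedAddCommGroup H] [InnerProductSpace ℂ H] [CompleteSpace H]
    {ι : Type*} (b : HilbertBasis ι ℂ H) (S T : H →L[ℂ] H) (c : ℝ) (hc : 0 ≤ c)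
    (h : ∀ x, ‖S x‖ ≤ c * ‖T x‖) : hsNorm b S ≤ ENNReal.ofReal c * hsNorm b T := by
  unfold hsNorm
  have h1 : ∑' i : ι, (‖S (b i)‖₊ : ℝ≥0∞) ^ 2 ≤
      ENNReal.ofReal c ^ 2 * ∑' i : ι, (‖T (b i)‖₊ : ℝ≥0∞) ^ 2 := by
    rw [← ENNReal.tsum_mul_left]
    refine ENNReal.tsum_le_tsum fun i => ?_
    rw [← mul_pow]
    refine pow_le_pow_left' ?_ 2
    have := ENNReal.ofReal_le_ofReal (h (b i))
    rw [ENNReal.ofReal_mul hc] at this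
    simpa [ofReal_norm_eq_enorm, enorm_eq_nnnorm] using this
  refine (ENNReal.rpow_le_rpow h1 (by norm_num)).trans_eq ?_
  rw [ENNReal.mul_rpow_of_nonneg _ _ (by norm_num), ← ENNReal.rpow_natCast, ← ENNReal.rpow_mul]
  norm_num

/-- **`sinh θ` is Hilbert–Schmidt iff `θ` is, for `θ ≥ 0`**, with the bounds
`‖θ‖_HS ≤ ‖sinh θ‖_HS ≤ cosh ‖θ‖ · ‖θ‖_HS`.  Here `sinh θ` is defined by the
continuous functional calculus. -/
theorem sinh_hilbertSchmidt_iff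
    {H : Type*} [NormedAddCommGroup H] [InnerProductSpace ℂ H] [CompleteSpace H]
    {ι : Type*} (b : HilbertBasis ι ℂ H)
    (θ : H →L[ℂ] H) (hθ : θ.IsPositive) :
    (hsNorm b (cfc Real.sinh θ) < ⊤ ↔ hsNorm b θ < ⊤) ∧
      hsNorm b θ ≤ hsNorm b (cfc Real.sinh θ) ∧
      hsNorm b (cfc Real.sinh θ) ≤ ENNReal.ofReal (Real.cosh ‖θ‖) * hsNorm b θ := by
  have hsa : IsSelfAdjoint θ := hθ.isSelfAdjoint
  have h0 : 0 ≤ θ := (ContinuousLinearMap.nonneg_iff_isPositive θ).2 hθ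
  have hpos : ∀ t ∈ spectrum ℝ θ, 0 ≤ t := fun t ht => spectrum_nonneg_of_nonneg h0 ht
  have hid : cfc (fun t : ℝ => t) θ = θ := cfc_id' ℝ θ
  have hA : hsNorm b θ ≤ hsNorm b (cfc Real.sinh θ) := by
    have := hsNorm_le_mul b θ (cfc Real.sinh θ) 1 zero_le_one (fun x => by
      have := norm_cfc_apply_le θ (fun t => t) Real.sinh continuous_id Real.continuous_sinh
        (fun t ht => by
          have h1 := hpos t ht
          have h2 := Real.self_le_sinh_iff.2 h1
          exact mul_self_le_mul_self h1 h2) x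
      rw [hid] at this
      simpa using this)
    simpa using this
  have hB : hsNorm b (cfc Real.sinh θ) ≤ ENNReal.ofReal (Real.cosh ‖θ‖) * hsNorm b θ := by
    refine hsNorm_le_mul b _ _ _ (Real.cosh_pos _).le (fun x => ?_)
    have := norm_cfc_apply_le θ Real.sinh (fun t => Real.cosh ‖θ‖ * t) Real.continuous_sinh
        (by fun_prop) (fun t ht => by
          have h1 := hpos t ht
          have h3 : t ≤ ‖θ‖ := by
            rcases subsingleton_or_nontrivial H with hH | hH
            · exact absurd ht (by simp [spectrum.of_subsingleton])
            · exact (le_abs_self t).trans (spectrum.norm_le_norm_of_mem ht)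
          exact mul_self_le_mul_self (Real.sinh_nonneg_iff.2 h1) (sinh_le_cosh_mul h1 h3)) x
    rw [cfc_const_mul (Real.cosh ‖θ‖) (fun t : ℝ => t) θ, hid] at this
    rw [ContinuousLinearMap.smul_apply, norm_smul, Real.norm_of_nonneg (Real.cosh_pos _).le] at this
    exact this
  exact ⟨⟨fun h => hA.trans_lt h,
    fun h => hB.trans_lt (ENNReal.mul_lt_top ENNReal.ofReal_lt_top h)⟩, hA, hB⟩
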